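/- For any free presentation 0 → R → F →^π L → 0 of a Lie superalgebra L over a field F (char F ≠ 2,3), the epicenter satisfies Z*(L) = π̄(Z(F/[R,F])), where π̄: F/[R,F] → L is the homomorphism induced by π. -/

import Mathlib

/-!
Common definitions: Lie superalgebras over a field `F` (char ≠ 2,3 where needed),
graded ideals, centers, capability, epicenter, non-abelian tensor and exterior
products (characterized by generators-and-relations universal properties),
free Lie superalgebras, Schur multipliers, Heisenberg Lie superalgebras, etc.
-/

namespace SuperLie

open Submodule Function Module

universe u v w

/-- The sign `(-1)^{|a||b|}` attached to a pair of `ℤ₂`-degrees. -/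
def sg (F : Type u) [Field F] (a b : ZMod 2) : F := (-1 : F) ^ (a.val * b.val)

/-- A Lie superalgebra over `F`: a `ℤ₂`-graded vector space `L = L₀ ⊕ L₁`
together with an even bilinear bracket satisfying graded skew-symmetry and the
graded Jacobi identity (on homogeneous elements). -/
class LieSuper (F : Type u) [Field F] (L : Type v) [AddCommGroup L] [Module F L] where
  gr : ZMod 2 → Submodule F L
  isCompl_gr : IsCompl (gr 0) (gr 1)
  br : L → L → L
  br_add_left : ∀ x y z : L, br (x + y) z = br x z + br y z
  br_add_right : ∀ x y z : L, br x (y + z) = br x y + br x z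
  br_smul_left : ∀ (c : F) (x y : L), br (c • x) y = c • br x y
  br_smul_right : ∀ (c : F) (x y : L), br x (c • y) = c • br x y
  br_gr : ∀ a b : ZMod 2, ∀ x ∈ gr a, ∀ y ∈ gr b, br x y ∈ gr (a + b)
  br_skew : ∀ a b : ZMod 2, ∀ x ∈ gr a, ∀ y ∈ gr b, br x y = -(sg F a b) • br y x
  br_jacobi : ∀ a b c : ZMod 2, ∀ x ∈ gr a, ∀ y ∈ gr b, ∀ z ∈ gr c,
    sg F a c • br x (br y z) + sg F b a • br y (br z x) + sg F c b • br z (br x y) = 0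

/-- The `a`-graded piece of a Lie superalgebra. -/
def grd (F : Type u) [Field F] (L : Type v) [AddCommGroup L] [Module F L] [LieSuper F L]
    (a : ZMod 2) : Submodule F L :=
  LieSuper.gr a

/-- The bracket of a Lie superalgebra. -/
def sbr (F : Type u) [Field F] {L : Type v} [AddCommGroup L] [Module F L] [LieSuper F L]
    (x y : L) : L :=
  LieSuper.br (F := F) x y

/-- The center `Z(L) = {z ∈ L : [z,x] = 0 for all x ∈ L}`. -/
def centerS (F : Type u) [Field F] (L : Type v) [AddCommGroup L] [Module F L] [LieSuper F L] :
    Submodule F L where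
  carrier := {z : L | ∀ x : L, sbr F z x = 0}
  add_mem' := by
    intro a b ha hb x
    simp only [Set.mem_setOf_eq, sbr] at ha hb ⊢
    rw [LieSuper.br_add_left, ha x, hb x, add_zero]
  zero_mem' := by
    intro x
    have h := LieSuper.br_smul_left (F := F) (0 : F) (0 : L) x
    simp only [Set.mem_setOf_eq, sbr, zero_smul] at h ⊢
    simpa using h
  smul_mem' := by
    intro c a ha x
    simp only [Set.mem_setOf_eq, sbr] at ha ⊢
    rw [LieSuper.br_smul_left, ha x, smul_zero]

/-- Homomorphisms of Lie superalgebras: even (grading preserving) linear maps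
which preserve the bracket. -/
def IsHom (F : Type u) [Field F] {L : Type v} {M : Type w}
    [AddCommGroup L] [Module F L] [LieSuper F L]
    [AddCommGroup M] [Module F M] [LieSuper F M] (f : L →ₗ[F] M) : Prop :=
  (∀ a : ZMod 2, ∀ x ∈ grd F L a, f x ∈ grd F M a) ∧
  (∀ x y : L, f (sbr F x y) = sbr F (f x) (f y))

/-- A bundled Lie superalgebra over `F`. -/
structure LieSupAlg (F : Type u) [Field F] : Type (max u (v + 1)) where
  carrier : Type v
  [iag : AddCommGroup carrier]
  [imo : Module F carrier]
  [ils : LieSuper F carrier]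

attribute [instance] LieSupAlg.iag LieSupAlg.imo LieSupAlg.ils

instance (F : Type u) [Field F] : CoeSort (LieSupAlg.{u, v} F) (Type v) :=
  ⟨LieSupAlg.carrier⟩

/-- A Lie superalgebra `L` is capable if `L ≅ H/Z(H)` for some Lie superalgebra `H`,
i.e. there is a surjective homomorphism onto `L` whose kernel is exactly the center. -/
def Capable (F : Type u) [Field F] (L : Type v) [AddCommGroup L] [Module F L]
    [LieSuper F L] : Prop :=
  ∃ (H : LieSupAlg.{u, max u v} F) (φ : H.carrier →ₗ[F] L),
    IsHom F φ ∧ Surjective φ ∧ LinearMap.ker φ = centerS F H.carrier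

/-- Graded ideals of a Lie superalgebra. -/
def IsGIdeal (F : Type u) [Field F] {L : Type v} [AddCommGroup L] [Module F L]
    [LieSuper F L] (I : Submodule F L) : Prop :=
  (∀ x ∈ I, ∀ y : L, sbr F x y ∈ I) ∧ (∀ y : L, ∀ x ∈ I, sbr F y x ∈ I) ∧
  (∀ x ∈ I, ∃ x0 ∈ I ⊓ grd F L 0, ∃ x1 ∈ I ⊓ grd F L 1, x = x0 + x1)

/-- The graded ideal generated by a subset. -/
def idealClosure (F : Type u) [Field F] {L : Type v} [AddCommGroup L] [Module F L]
    [LieSuper F L] (S : Set L) : Submodule F L :=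
  sInf {I : Submodule F L | IsGIdeal F I ∧ S ⊆ ↑I}

/-- `QuotCapable F L N` expresses that the quotient Lie superalgebra `L/N` is capable. -/
def QuotCapable (F : Type u) [Field F] (L : Type v) [AddCommGroup L] [Module F L]
    [LieSuper F L] (N : Submodule F L) : Prop :=
  ∃ (Q : LieSupAlg.{u, max u v} F) (π : L →ₗ[F] Q.carrier),
    IsHom F π ∧ Surjective π ∧ LinearMap.ker π = N ∧ Capable F Q.carrier

/-- The epicenter `Z^*(L)`: the smallest graded ideal of `L` such that the
corresponding quotient is capable. -/
def IsEpicenter (F : Type u) [Field F] (L : Type v) [AddCommGroup L] [Module F L]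
    [LieSuper F L] (Z : Submodule F L) : Prop :=
  IsGIdeal F Z ∧ QuotCapable F L Z ∧
  ∀ N : Submodule F L, IsGIdeal F N → QuotCapable F L N → Z ≤ N

/-- The submodule `[I,J]` spanned by brackets. -/
def bracketSpan (F : Type u) [Field F] {L : Type v} [AddCommGroup L] [Module F L]
    [LieSuper F L] (I J : Submodule F L) : Submodule F L :=
  Submodule.span F {z : L | ∃ x ∈ I, ∃ y ∈ J, z = sbr F x y}

/-- The derived subalgebra `L' = [L,L]`. -/
def derived (F : Type u) [Field F] (L : Type v) [AddCommGroup L] [Module F L]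
    [LieSuper F L] : Submodule F L :=
  bracketSpan F (⊤ : Submodule F L) ⊤

/-- The lower central series of a Lie superalgebra. -/
def lowerCentral (F : Type u) [Field F] (L : Type v) [AddCommGroup L] [Module F L]
    [LieSuper F L] : ℕ → Submodule F L
  | 0 => ⊤
  | n + 1 => bracketSpan F (lowerCentral F L n) ⊤

/-- A Lie superalgebra is nilpotent if its lower central series terminates at zero. -/
def IsNilp (F : Type u) [Field F] (L : Type v) [AddCommGroup L] [Module F L]
    [LieSuper F L] : Prop :=
  ∃ n : ℕ, lowerCentral F L n = ⊥

/-- An action of a Lie superalgebra `P` on a Lie superalgebra `M`: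
an even bilinear map satisfying the two action axioms. -/
structure IsAction (F : Type u) [Field F] {P : Type v} {M : Type v}
    [AddCommGroup P] [Module F P] [LieSuper F P]
    [AddCommGroup M] [Module F M] [LieSuper F M] (act : P → M → M) : Prop where
  add_left : ∀ (p q : P) (m : M), act (p + q) m = act p m + act q m
  add_right : ∀ (p : P) (m m' : M), act p (m + m') = act p m + act p m'
  smul_left : ∀ (c : F) (p : P) (m : M), act (c • p) m = c • act p m
  smul_right : ∀ (c : F) (p : P) (m : M), act p (c • m) = c • act p m
  grade : ∀ a b : ZMod 2, ∀ p ∈ grd F P a, ∀ m ∈ grd F M b, act p m ∈ grd F M (a + b)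
  br_act : ∀ a b : ZMod 2, ∀ p ∈ grd F P a, ∀ p' ∈ grd F P b, ∀ m : M,
    act (sbr F p p') m = act p (act p' m) - sg F a b • act p' (act p m)
  act_br : ∀ a b : ZMod 2, ∀ p ∈ grd F P a, ∀ m ∈ grd F M b, ∀ m' : M,
    act p (sbr F m m') = sbr F (act p m) m' + sg F a b • sbr F m (act p m')

/-- Compatibility of mutual actions of two Lie superalgebras on each other. -/
def Compatible (F : Type u) [Field F] {M : Type v} {N : Type v}
    [AddCommGroup M] [Module F M] [LieSuper F M]
    [AddCommGroup N] [Module F N] [LieSuper F N]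
    (actMN : M → N → N) (actNM : N → M → M) : Prop :=
  (∀ a b : ZMod 2, ∀ m ∈ grd F M a, ∀ n ∈ grd F N b, ∀ n' : N,
      actMN (actNM n m) n' = -(sg F a b) • sbr F (actMN m n) n') ∧
  (∀ a b : ZMod 2, ∀ m ∈ grd F M a, ∀ n ∈ grd F N b, ∀ m' : M,
      actNM (actMN m n) m' = -(sg F a b) • sbr F (actNM n m) m')

/-- The defining relations of the non-abelian tensor product `M ⊗ N` of Lie
superalgebras (with given mutual actions), satisfied by a pairing `q` into `T`. -/
structure TensorRel (F : Type u) [Field F] {M : Type v} {N : Type v} {T : Type w}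
    [AddCommGroup M] [Module F M] [LieSuper F M]
    [AddCommGroup N] [Module F N] [LieSuper F N]
    [AddCommGroup T] [Module F T] [LieSuper F T]
    (actMN : M → N → N) (actNM : N → M → M) (q : M → N → T) : Prop where
  add_left : ∀ (m m' : M) (n : N), q (m + m') n = q m n + q m' n
  add_right : ∀ (m : M) (n n' : N), q m (n + n') = q m n + q m n'
  smul_left : ∀ (c : F) (m : M) (n : N), q (c • m) n = c • q m n
  smul_right : ∀ (c : F) (m : M) (n : N), q m (c • n) = c • q m n
  grade : ∀ a b : ZMod 2, ∀ m ∈ grd F M a, ∀ n ∈ grd F N b, q m n ∈ grd F T (a + b)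
  brk_left : ∀ a b : ZMod 2, ∀ m ∈ grd F M a, ∀ m' ∈ grd F M b, ∀ n : N,
    q (sbr F m m') n = q m (actMN m' n) - sg F a b • q m' (actMN m n)
  brk_right : ∀ a b c : ZMod 2, ∀ m ∈ grd F M a, ∀ n ∈ grd F N b, ∀ n' ∈ grd F N c,
    q m (sbr F n n') = sg F c (a + b) • q (actNM n' m) n - sg F a b • q (actNM n m) n'
  brk_brk : ∀ a b : ZMod 2, ∀ m ∈ grd F M a, ∀ n ∈ grd F N b, ∀ (m' : M) (n' : N),
    sbr F (q m n) (q m' n') = -(sg F a b) • q (actNM n m) (actMN m' n')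

/-- `IsTensorObj F actMN actNM t` says that `(T, t)` is the non-abelian tensor
product `M ⊗ N`: the pairing `t` satisfies the defining relations and is
universal among all pairings satisfying them. -/
structure IsTensorObj (F : Type u) [Field F] {M : Type v} {N : Type v} {T : Type v}
    [AddCommGroup M] [Module F M] [LieSuper F M]
    [AddCommGroup N] [Module F N] [LieSuper F N]
    [AddCommGroup T] [Module F T] [LieSuper F T]
    (actMN : M → N → N) (actNM : N → M → M) (t : M → N → T) : Prop where
  rel : TensorRel F actMN actNM t
  lift : ∀ (Q : LieSupAlg.{u, max u v} F) (q : M → N → Q.carrier),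
    TensorRel F actMN actNM q →
    ∃! h : T →ₗ[F] Q.carrier, IsHom F h ∧ ∀ (m : M) (n : N), h (t m n) = q m n

/-- The defining relations of the non-abelian exterior square `L ∧ L` of a Lie
superalgebra (the tensor relations for the bracket actions, together with the
graded alternating relations coming from `L □ L`). -/
structure ExtRel (F : Type u) [Field F] {L : Type v} {T : Type w}
    [AddCommGroup L] [Module F L] [LieSuper F L]
    [AddCommGroup T] [Module F T] [LieSuper F T] (q : L → L → T) : Prop where
  toTensor : TensorRel F (fun x y : L => sbr F x y) (fun x y : L => sbr F x y) q
  alt : ∀ a b : ZMod 2, ∀ x ∈ grd F L a, ∀ y ∈ grd F L b, q x y = -(sg F a b) • q y x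
  alt_even : ∀ x ∈ grd F L 0, q x x = 0

/-- `IsExtObj F t` says that `(E, t)` is the non-abelian exterior square `L ∧ L`. -/
structure IsExtObj (F : Type u) [Field F] {L : Type v} {E : Type v}
    [AddCommGroup L] [Module F L] [LieSuper F L]
    [AddCommGroup E] [Module F E] [LieSuper F E] (t : L → L → E) : Prop where
  rel : ExtRel F t
  lift : ∀ (Q : LieSupAlg.{u, max u v} F) (q : L → L → Q.carrier),
    ExtRel F q →
    ∃! h : E →ₗ[F] Q.carrier, IsHom F h ∧ ∀ x y : L, h (t x y) = q x y

/-- A free Lie superalgebra: free on some `ℤ₂`-graded subset `X`. -/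
def IsFreeLieSuper (F : Type u) [Field F] (Fr : Type v) [AddCommGroup Fr] [Module F Fr]
    [LieSuper F Fr] : Prop :=
  ∃ X : ZMod 2 → Set Fr,
    (∀ a : ZMod 2, X a ⊆ (grd F Fr a : Set Fr)) ∧
    ∀ (Q : LieSupAlg.{u, max u v} F) (f : ∀ a : ZMod 2, X a → Q.carrier),
      (∀ (a : ZMod 2) (x : X a), f a x ∈ grd F Q.carrier a) →
      ∃! h : Fr →ₗ[F] Q.carrier,
        IsHom F h ∧ ∀ (a : ZMod 2) (x : X a), h (x : Fr) = f a x

/-- `F' ∩ R`, for a free presentation with kernel `R`. -/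
abbrev schurA (F : Type u) [Field F] (Fr : Type v) [AddCommGroup Fr] [Module F Fr]
    [LieSuper F Fr] (R : Submodule F Fr) : Submodule F Fr :=
  derived F Fr ⊓ R

/-- The Schur multiplier `M(L) = (F' ∩ R)/[R,F]` attached to a free presentation
`0 → R → F → L → 0`. -/
abbrev SchurMul (F : Type u) [Field F] (Fr : Type v) [AddCommGroup Fr] [Module F Fr]
    [LieSuper F Fr] (R : Submodule F Fr) :=
  ↥(schurA F Fr R) ⧸ (Submodule.comap (schurA F Fr R).subtype (bracketSpan F R ⊤))

/-- `L` is (isomorphic to) the special Heisenberg Lie superalgebra `H(m,n)` with even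
center: basis `x₁,…,x_{2m}, z` (even), `y₁,…,y_n` (odd), with `[xᵢ, x_{m+i}] = z`,
`[y_j, y_j] = z` and `z` central. -/
def IsHeisE (F : Type u) [Field F] (m n : ℕ) (L : Type v) [AddCommGroup L] [Module F L]
    [LieSuper F L] : Prop :=
  ∃ (x : Fin (2 * m) → L) (y : Fin n → L) (z : L),
    (∀ i, x i ∈ grd F L 0) ∧ z ∈ grd F L 0 ∧ (∀ j, y j ∈ grd F L 1) ∧
    LinearIndependent F (Sum.elim x (Sum.elim y (fun _ : Unit => z))) ∧
    Submodule.span F (Set.range (Sum.elim x (Sum.elim y (fun _ : Unit => z)))) = ⊤ ∧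
    (∀ i j : Fin (2 * m), sbr F (x i) (x j) =
      if (j : ℕ) = (i : ℕ) + m then z else if (i : ℕ) = (j : ℕ) + m then -z else 0) ∧
    (∀ (i : Fin (2 * m)) (j : Fin n), sbr F (x i) (y j) = 0) ∧
    (∀ (i : Fin (2 * m)) (j : Fin n), sbr F (y j) (x i) = 0) ∧
    (∀ i j : Fin n, sbr F (y i) (y j) = if i = j then z else 0) ∧
    (∀ w : L, sbr F z w = 0) ∧ (∀ w : L, sbr F w z = 0)

/-- `L` is (isomorphic to) the Heisenberg Lie superalgebra `H_m` with odd center: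
basis `x₁,…,x_m` (even), `y₁,…,y_m, z` (odd), with `[x_j, y_j] = z` and `z` central. -/
def IsHeisO (F : Type u) [Field F] (m : ℕ) (L : Type v) [AddCommGroup L] [Module F L]
    [LieSuper F L] : Prop :=
  ∃ (x : Fin m → L) (y : Fin m → L) (z : L),
    (∀ i, x i ∈ grd F L 0) ∧ (∀ j, y j ∈ grd F L 1) ∧ z ∈ grd F L 1 ∧
    LinearIndependent F (Sum.elim x (Sum.elim y (fun _ : Unit => z))) ∧
    Submodule.span F (Set.range (Sum.elim x (Sum.elim y (fun _ : Unit => z)))) = ⊤ ∧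
    (∀ i j : Fin m, sbr F (x i) (x j) = 0) ∧
    (∀ i j : Fin m, sbr F (x i) (y j) = if i = j then z else 0) ∧
    (∀ i j : Fin m, sbr F (y j) (x i) = if i = j then -z else 0) ∧
    (∀ i j : Fin m, sbr F (y i) (y j) = 0) ∧
    (∀ w : L, sbr F z w = 0) ∧ (∀ w : L, sbr F w z = 0)

/-- `A` is (isomorphic to) the abelian Lie superalgebra `A(r | s)` of
superdimension `(r | s)`. -/
def IsAbelSuper (F : Type u) [Field F] (r s : ℕ) (A : Type v) [AddCommGroup A]
    [Module F A] [LieSuper F A] : Prop :=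
  (∀ x y : A, sbr F x y = 0) ∧ Module.Finite F A ∧
  Module.finrank F ↥(grd F A 0) = r ∧ Module.finrank F ↥(grd F A 1) = s

/-- The direct sum (product) of two Lie superalgebras. -/
instance prodLieSuper (F : Type u) [Field F] (A : Type v) (B : Type w)
    [AddCommGroup A] [Module F A] [LieSuper F A]
    [AddCommGroup B] [Module F B] [LieSuper F B] : LieSuper F (A × B) where
  gr a := (grd F A a).prod (grd F B a)
  isCompl_gr := by
    have hA : IsCompl (grd F A 0) (grd F A 1) := LieSuper.isCompl_gr
    have hB : IsCompl (grd F B 0) (grd F B 1) := LieSuper.isCompl_gr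
    constructor
    · rw [disjoint_iff, eq_bot_iff]
      rintro ⟨a, b⟩ h
      rw [Submodule.mem_inf] at h
      obtain ⟨h0, h1⟩ := h
      rw [Submodule.mem_prod] at h0 h1
      have ha : a = 0 := by
        have := hA.disjoint.le_bot (Submodule.mem_inf.mpr ⟨h0.1, h1.1⟩)
        simpa using this
      have hb : b = 0 := by
        have := hB.disjoint.le_bot (Submodule.mem_inf.mpr ⟨h0.2, h1.2⟩)
        simpa using this
      simp [ha, hb, Prod.ext_iff]
    · rw [codisjoint_iff, eq_top_iff]
      rintro ⟨a, b⟩ -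
      have ha' : a ∈ grd F A 0 ⊔ grd F A 1 := by
        rw [hA.codisjoint.eq_top]; trivial
      have hb' : b ∈ grd F B 0 ⊔ grd F B 1 := by
        rw [hB.codisjoint.eq_top]; trivial
      obtain ⟨a0, ha0, a1, ha1, rfl⟩ := Submodule.mem_sup.mp ha'
      obtain ⟨b0, hb0, b1, hb1, rfl⟩ := Submodule.mem_sup.mp hb'
      refine Submodule.mem_sup.mpr ⟨(a0, b0), ?_, (a1, b1), ?_, ?_⟩
      · exact Submodule.mem_prod.mpr ⟨ha0, hb0⟩
      · exact Submodule.mem_prod.mpr ⟨ha1, hb1⟩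
      · rfl
  br x y := (sbr F x.1 y.1, sbr F x.2 y.2)
  br_add_left := by
    intro x y z
    simp only [Prod.fst_add, Prod.snd_add, sbr, LieSuper.br_add_left]
    rfl
  br_add_right := by
    intro x y z
    simp only [Prod.fst_add, Prod.snd_add, sbr, LieSuper.br_add_right]
    rfl
  br_smul_left := by
    intro c x y
    simp only [Prod.smul_fst, Prod.smul_snd, sbr, LieSuper.br_smul_left]
    rfl
  br_smul_right := by
    intro c x y
    simp only [Prod.smul_fst, Prod.smul_snd, sbr, LieSuper.br_smul_right]
    rfl
  br_gr := by
    intro a b x hx y hy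
    rw [Submodule.mem_prod] at hx hy ⊢
    exact ⟨LieSuper.br_gr a b x.1 hx.1 y.1 hy.1, LieSuper.br_gr a b x.2 hx.2 y.2 hy.2⟩
  br_skew := by
    intro a b x hx y hy
    rw [Submodule.mem_prod] at hx hy
    have h1 := LieSuper.br_skew (F := F) a b x.1 hx.1 y.1 hy.1
    have h2 := LieSuper.br_skew (F := F) a b x.2 hx.2 y.2 hy.2
    simp only [sbr]
    rw [Prod.ext_iff]
    exact ⟨h1, h2⟩
  br_jacobi := by
    intro a b c x hx y hy z hz
    rw [Submodule.mem_prod] at hx hy hz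
    have h1 := LieSuper.br_jacobi (F := F) a b c x.1 hx.1 y.1 hy.1 z.1 hz.1
    have h2 := LieSuper.br_jacobi (F := F) a b c x.2 hx.2 y.2 hy.2 z.2 hz.2
    simp only [sbr]
    rw [Prod.ext_iff]
    exact ⟨h1, h2⟩

section Helpers

variable (F : Type u) [Field F] {L : Type v} [AddCommGroup L] [Module F L] [LieSuper F L]

theorem sbr_add_left (x y z : L) : sbr F (x + y) z = sbr F x z + sbr F y z :=
  LieSuper.br_add_left x y z

theorem sbr_add_right (x y z : L) : sbr F x (y + z) = sbr F x y + sbr F x z :=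
  LieSuper.br_add_right x y z

theorem sbr_zero_right (x : L) : sbr F x (0 : L) = 0 := by
  have h := LieSuper.br_smul_right (F := F) (0 : F) x (0 : L)
  simpa [sbr] using h

theorem grd_decomp (x : L) : ∃ x0 ∈ grd F L 0, ∃ x1 ∈ grd F L 1, x = x0 + x1 := by
  have hA : IsCompl (grd F L 0) (grd F L 1) := LieSuper.isCompl_gr
  have h : x ∈ grd F L 0 ⊔ grd F L 1 := by rw [hA.codisjoint.eq_top]; trivial
  obtain ⟨a, ha, b, hb, h⟩ := Submodule.mem_sup.mp h
  exact ⟨a, ha, b, hb, h.symm⟩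

theorem grd_indep (x y : L) (hx : x ∈ grd F L 0) (hy : y ∈ grd F L 1) (h : x + y = 0) :
    x = 0 ∧ y = 0 := by
  have hA : IsCompl (grd F L 0) (grd F L 1) := LieSuper.isCompl_gr
  have h2 : x = -y := eq_neg_of_add_eq_zero_left h
  have h3 : x ∈ grd F L 1 := by rw [h2]; exact neg_mem hy
  have h4 := hA.disjoint.le_bot (Submodule.mem_inf.mpr ⟨hx, h3⟩)
  have h5 : x = 0 := by simpa using h4
  refine ⟨h5, ?_⟩
  rw [h5] at h; simpa using h

theorem hom_decomp (x y : L) (hx : ∀ a, ∀ w ∈ grd F L a, sbr F x w = 0) : sbr F x y = 0 := by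
  obtain ⟨y0, h0, y1, h1, rfl⟩ := grd_decomp F y
  rw [sbr_add_right, hx 0 y0 h0, hx 1 y1 h1, add_zero]

/-- homogeneous components of central elements are central -/
theorem center_comp (x0 x1 : L) (h0 : x0 ∈ grd F L 0) (h1 : x1 ∈ grd F L 1)
    (h : x0 + x1 ∈ centerS F L) : x0 ∈ centerS F L ∧ x1 ∈ centerS F L := by
  have key : ∀ a, ∀ w ∈ grd F L a, sbr F x0 w = 0 ∧ sbr F x1 w = 0 := by
    intro a w hw
    have e : sbr F x0 w + sbr F x1 w = 0 := by rw [← sbr_add_left]; exact h w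
    have g0 : sbr F x0 w ∈ grd F L (0 + a) := LieSuper.br_gr 0 a x0 h0 w hw
    have g1 : sbr F x1 w ∈ grd F L (1 + a) := LieSuper.br_gr 1 a x1 h1 w hw
    have ha : a = 0 ∨ a = 1 := (by decide : ∀ b : ZMod 2, b = 0 ∨ b = 1) a
    rcases ha with rfl | rfl
    · exact grd_indep F _ _ g0 g1 e
    · rw [add_comm] at e
      exact (grd_indep F _ _ g1 g0 e).symm
  exact ⟨fun y => hom_decomp F x0 y fun a w hw => (key a w hw).1,
    fun y => hom_decomp F x1 y fun a w hw => (key a w hw).2⟩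

theorem center_right_hom (a : ZMod 2) (c y : L) (hc : c ∈ centerS F L) (hca : c ∈ grd F L a) :
    sbr F y c = 0 := by
  have key : ∀ b, ∀ w ∈ grd F L b, sbr F w c = 0 := by
    intro b w hw
    have := LieSuper.br_skew (F := F) b a w hw c hca
    have h2 : LieSuper.br (F := F) c w = 0 := hc w
    rw [h2, smul_zero] at this
    exact this
  obtain ⟨y0, h0, y1, h1, rfl⟩ := grd_decomp F y
  rw [sbr_add_left, key 0 y0 h0, key 1 y1 h1, add_zero]

theorem center_right (c y : L) (hc : c ∈ centerS F L) : sbr F y c = 0 := by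
  obtain ⟨c0, h0, c1, h1, rfl⟩ := grd_decomp F c
  obtain ⟨k0, k1⟩ := center_comp F c0 c1 h0 h1 hc
  rw [sbr_add_right, center_right_hom F 0 c0 y k0 h0, center_right_hom F 1 c1 y k1 h1, add_zero]

theorem sbr_congr (x x' y y' : L) (hx : x - x' ∈ centerS F L) (hy : y - y' ∈ centerS F L) :
    sbr F x y = sbr F x' y' := by
  have e1 : sbr F x y = sbr F x' y := by
    have : sbr F ((x - x') + x') y = sbr F x' y := by rw [sbr_add_left, hx y, zero_add]
    simpa using this
  have e2 : sbr F x' y = sbr F x' y' := by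
    have : sbr F x' ((y - y') + y') = sbr F x' y' := by
      rw [sbr_add_right, center_right F _ _ hy, zero_add]
    simpa using this
  rw [e1, e2]

variable (L) in
/-- The bracket on `L/Z(L)`. -/
noncomputable def qbr (x y : L ⧸ centerS F L) : L ⧸ centerS F L :=
  (centerS F L).mkQ (sbr F (Quotient.out x) (Quotient.out y))

theorem qbr_mk (x y : L) : qbr F L ((centerS F L).mkQ x) ((centerS F L).mkQ y) =
    (centerS F L).mkQ (sbr F x y) := by
  unfold qbr
  rw [sbr_congr F _ x _ y]
  · exact (Submodule.Quotient.eq _).mp (Quotient.out_eq _)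
  · exact (Submodule.Quotient.eq _).mp (Quotient.out_eq _)

variable (L) in
/-- The quotient Lie superalgebra `L/Z(L)`. -/
@[reducible] noncomputable def quotLS : LieSuper F (L ⧸ centerS F L) where
  gr a := (grd F L a).map (centerS F L).mkQ
  isCompl_gr := by
    constructor
    · rw [disjoint_iff, eq_bot_iff]
      rintro _ ⟨⟨x, hx, rfl⟩, ⟨y, hy, e⟩⟩
      have h : x + -y ∈ centerS F L := by
        rw [← sub_eq_add_neg]
        exact (Submodule.Quotient.eq _).mp e.symm
      have := (center_comp F x (-y) hx (neg_mem hy) h).1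
      simpa using this
    · rw [codisjoint_iff, eq_top_iff]
      intro x _
      obtain ⟨x, rfl⟩ := (centerS F L).mkQ_surjective x
      obtain ⟨a, ha, b, hb, rfl⟩ := grd_decomp F x
      rw [map_add]
      exact Submodule.add_mem_sup (Submodule.mem_map_of_mem ha) (Submodule.mem_map_of_mem hb)
  br := qbr F L
  br_add_left := by
    intro x y z
    obtain ⟨x, rfl⟩ := (centerS F L).mkQ_surjective x
    obtain ⟨y, rfl⟩ := (centerS F L).mkQ_surjective y
    obtain ⟨z, rfl⟩ := (centerS F L).mkQ_surjective z
    rw [← map_add, qbr_mk, qbr_mk, qbr_mk, ← map_add, sbr_add_left]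
  br_add_right := by
    intro x y z
    obtain ⟨x, rfl⟩ := (centerS F L).mkQ_surjective x
    obtain ⟨y, rfl⟩ := (centerS F L).mkQ_surjective y
    obtain ⟨z, rfl⟩ := (centerS F L).mkQ_surjective z
    rw [← map_add, qbr_mk, qbr_mk, qbr_mk, ← map_add, sbr_add_right]
  br_smul_left := by
    intro c x y
    obtain ⟨x, rfl⟩ := (centerS F L).mkQ_surjective x
    obtain ⟨y, rfl⟩ := (centerS F L).mkQ_surjective y
    rw [← map_smul, qbr_mk, qbr_mk, ← map_smul]
    exact congrArg _ (LieSuper.br_smul_left c x y)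
  br_smul_right := by
    intro c x y
    obtain ⟨x, rfl⟩ := (centerS F L).mkQ_surjective x
    obtain ⟨y, rfl⟩ := (centerS F L).mkQ_surjective y
    rw [← map_smul, qbr_mk, qbr_mk, ← map_smul]
    exact congrArg _ (LieSuper.br_smul_right c x y)
  br_gr := by
    rintro a b _ ⟨x, hx, rfl⟩ _ ⟨y, hy, rfl⟩
    rw [qbr_mk]
    exact Submodule.mem_map_of_mem (LieSuper.br_gr a b x hx y hy)
  br_skew := by
    rintro a b _ ⟨x, hx, rfl⟩ _ ⟨y, hy, rfl⟩
    rw [qbr_mk, qbr_mk, ← map_smul]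
    exact congrArg _ (LieSuper.br_skew a b x hx y hy)
  br_jacobi := by
    rintro a b c _ ⟨x, hx, rfl⟩ _ ⟨y, hy, rfl⟩ _ ⟨z, hz, rfl⟩
    simp only [qbr_mk]
    rw [← map_smul, ← map_smul, ← map_smul, ← map_add, ← map_add]
    exact (congrArg _ (LieSuper.br_jacobi a b c x hx y hy z hz)).trans (map_zero _)

/-- Homogeneous elements lift along surjective homomorphisms. -/
theorem hom_lift {M : Type w} [AddCommGroup M] [Module F M] [LieSuper F M]
    (f : L →ₗ[F] M) (hf : IsHom F f) (hs : Surjective f) (a : ZMod 2) (y : M)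
    (hy : y ∈ grd F M a) : ∃ x ∈ grd F L a, f x = y := by
  obtain ⟨x, rfl⟩ := hs y
  obtain ⟨x0, h0, x1, h1, rfl⟩ := grd_decomp F x
  have k0 := hf.1 0 x0 h0
  have k1 := hf.1 1 x1 h1
  rw [map_add] at hy ⊢
  have ha : a = 0 ∨ a = 1 := (by decide : ∀ b : ZMod 2, b = 0 ∨ b = 1) a
  rcases ha with rfl | rfl
  · refine ⟨x0, h0, ?_⟩
    have h2 : f x1 ∈ grd F M 0 := by simpa using sub_mem hy k0
    have := (grd_indep F (f x1) (-f x1) h2 (neg_mem k1) (by simp)).1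
    rw [this, add_zero]
  · refine ⟨x1, h1, ?_⟩
    have h2 : f x0 ∈ grd F M 1 := by simpa using sub_mem hy k1
    have := (grd_indep F (f x0) (-f x0) k0 (neg_mem h2) (by simp)).1
    rw [this, zero_add]

end Helpers

/-- for any free presentation `0 → R → F →^π L → 0` of a Lie
superalgebra `L`, the epicenter satisfies `Z*(L) = π̄(Z(F/[R,F]))`, where
`π̄ : F/[R,F] → L` is induced by `π`.  Here the quotient `F/[R,F]` is
represented by a surjective homomorphism `qm` with kernel `[R,F]`. -/
theorem epicenter_eq_image_center_of_free_presentation (F : Type u) [Field F]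
    (hchar2 : (2 : F) ≠ 0) (hchar3 : (3 : F) ≠ 0)
    (L : Type v) [AddCommGroup L] [Module F L] [LieSuper F L]
    (Fr : Type (max u v)) [AddCommGroup Fr] [Module F Fr] [LieSuper F Fr]
    (hfree : IsFreeLieSuper F Fr)
    (π : Fr →ₗ[F] L) (hπ : IsHom F π) (hπs : Surjective π)
    -- `Q` plays the role of the quotient `F/[R,F]`, with `R = ker π`:
    (Q : Type (max u v)) [AddCommGroup Q] [Module F Q] [LieSuper F Q]
    (qm : Fr →ₗ[F] Q) (hqm : IsHom F qm) (hqms : Surjective qm)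
    (hker : LinearMap.ker qm = bracketSpan F (LinearMap.ker π) ⊤)
    -- `π̄ : F/[R,F] → L` is the induced homomorphism:
    (πbar : Q →ₗ[F] L) (hπbar : IsHom F πbar) (hcomm : πbar ∘ₗ qm = π)
    (Z : Submodule F L) (hZ : IsEpicenter F L Z) :
    Z = Submodule.map πbar (centerS F Q) := by
  obtain ⟨hZi, hZq, hZmin⟩ := hZ
  have hcomm' : ∀ x, πbar (qm x) = π x := fun x => LinearMap.congr_fun hcomm x
  have hbs : Surjective πbar := by
    intro y
    obtain ⟨x, rfl⟩ := hπs y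
    exact ⟨qm x, hcomm' x⟩
  have hkc : LinearMap.ker πbar ≤ centerS F Q := by
    intro z hz y
    obtain ⟨r, rfl⟩ := hqms z
    obtain ⟨f, rfl⟩ := hqms y
    rw [← hqm.2]
    have : sbr F r f ∈ LinearMap.ker qm := by
      rw [hker]
      refine Submodule.subset_span ⟨r, ?_, f, trivial, rfl⟩
      rw [LinearMap.mem_ker, hcomm'] at hz
      exact hz
    exact this
  apply le_antisymm
  · apply hZmin
    · refine ⟨?_, ?_, ?_⟩
      · rintro _ ⟨x, hx, rfl⟩ y
        obtain ⟨y, rfl⟩ := hbs y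
        rw [← hπbar.2, hx y, map_zero]
        exact zero_mem _
      · rintro y _ ⟨x, hx, rfl⟩
        obtain ⟨y, rfl⟩ := hbs y
        rw [← hπbar.2, center_right F x y hx, map_zero]
        exact zero_mem _
      · rintro _ ⟨x, hx, rfl⟩
        obtain ⟨x0, h0, x1, h1, rfl⟩ := grd_decomp F x
        obtain ⟨k0, k1⟩ := center_comp F x0 x1 h0 h1 hx
        exact ⟨πbar x0, ⟨Submodule.mem_map_of_mem k0, hπbar.1 0 x0 h0⟩,
          πbar x1, ⟨Submodule.mem_map_of_mem k1, hπbar.1 1 x1 h1⟩, map_add _ _ _⟩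
    · letI : LieSuper F (Q ⧸ centerS F Q) := quotLS F Q
      have hmk : IsHom F (centerS F Q).mkQ :=
        ⟨fun a x hx => Submodule.mem_map_of_mem hx, fun x y => (qbr_mk F x y).symm⟩
      let p : L →ₗ[F] (Q ⧸ centerS F Q) :=
        ((LinearMap.ker πbar).liftQ (centerS F Q).mkQ (by rwa [Submodule.ker_mkQ])) ∘ₗ
          (πbar.quotKerEquivOfSurjective hbs).symm.toLinearMap
      have hp : ∀ x, p (πbar x) = (centerS F Q).mkQ x := by
        intro x
        have : (πbar.quotKerEquivOfSurjective hbs).symm (πbar x) = (LinearMap.ker πbar).mkQ x := by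
          rw [LinearEquiv.symm_apply_eq]
          rfl
        simp only [p, LinearMap.comp_apply, LinearEquiv.coe_coe, this]
        rfl
      refine ⟨⟨Q ⧸ centerS F Q⟩, p, ⟨?_, ?_⟩, ?_, ?_, ?_⟩
      · intro a y hy
        obtain ⟨x, hx, rfl⟩ := hom_lift F πbar hπbar hbs a y hy
        rw [hp]
        exact hmk.1 a x hx
      · intro x y
        obtain ⟨x, rfl⟩ := hbs x
        obtain ⟨y, rfl⟩ := hbs y
        rw [← hπbar.2, hp, hp, hp]
        exact hmk.2 x y
      · intro y
        obtain ⟨x, rfl⟩ := (centerS F Q).mkQ_surjective y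
        exact ⟨πbar x, hp x⟩
      · ext y
        obtain ⟨x, rfl⟩ := hbs y
        rw [LinearMap.mem_ker]
        constructor
        · intro h
          refine Submodule.mem_map_of_mem ?_
          rw [hp] at h
          rw [← Submodule.ker_mkQ (centerS F Q)]
          exact h
        · rintro ⟨c, hc, e⟩
          rw [← e, hp]
          exact (Submodule.Quotient.mk_eq_zero _).mpr hc
      · exact ⟨⟨Q⟩, (centerS F Q).mkQ, hmk, (centerS F Q).mkQ_surjective, Submodule.ker_mkQ _⟩
  · obtain ⟨Q', p, hp, hps, hpk, H, φ, hφ, hφs, hφk⟩ := hZq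
    obtain ⟨X, hX, huniv⟩ := hfree
    have hl : ∀ (a : ZMod 2) (x : X a), ∃ y ∈ grd F H.carrier a, φ y = p (π x) := fun a x =>
      hom_lift F φ hφ hφs a _ (hp.1 a _ (hπ.1 a _ (hX a x.2)))
    choose f hf hfe using hl
    obtain ⟨h, ⟨hh, hhx⟩, -⟩ := huniv H f hf
    have hcompat : φ ∘ₗ h = p ∘ₗ π := by
      refine (huniv Q' (fun a x => p (π x)) ?_).unique ⟨⟨?_, ?_⟩, ?_⟩ ⟨⟨?_, ?_⟩, ?_⟩
      · exact fun a x => hp.1 a _ (hπ.1 a _ (hX a x.2))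
      · exact fun a x hx => hφ.1 a _ (hh.1 a x hx)
      · intro x y
        simp only [LinearMap.comp_apply]
        rw [hh.2, hφ.2]
      · intro a x
        rw [LinearMap.comp_apply, hhx, hfe]
      · exact fun a x hx => hp.1 a _ (hπ.1 a _ hx)
      · intro x y
        simp only [LinearMap.comp_apply]
        rw [hπ.2, hp.2]
      · exact fun a x => rfl
    have hc : ∀ x, φ (h x) = p (π x) := fun x => LinearMap.congr_fun hcompat x
    have hkk : LinearMap.ker qm ≤ LinearMap.ker h := by
      rw [hker]
      refine Submodule.span_le.mpr ?_
      rintro _ ⟨r, hr, y, -, rfl⟩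
      have : h r ∈ centerS F H.carrier := by
        rw [← hφk, LinearMap.mem_ker, hc, LinearMap.mem_ker.mp hr, map_zero]
      rw [SetLike.mem_coe, LinearMap.mem_ker, hh.2]
      exact this _
    rintro _ ⟨z, hz, rfl⟩
    obtain ⟨x, rfl⟩ := hqms z
    rw [hcomm', ← hpk, LinearMap.mem_ker, ← hc, ← LinearMap.mem_ker, hφk]
    intro y
    obtain ⟨l, hl⟩ := hps (φ y)
    obtain ⟨x', rfl⟩ := hπs l
    have hy : y - h x' ∈ centerS F H.carrier := by
      rw [← hφk, LinearMap.mem_ker, map_sub, hc, hl, sub_self]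
    rw [sbr_congr F (h x) (h x) y (h x') (by rw [sub_self]; exact zero_mem _) hy, ← hh.2]
    apply hkk
    rw [LinearMap.mem_ker, hqm.2]
    exact hz _

end SuperLie
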